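/- arXiv:2207.02528 — 2 statements merged into one kernel-verified Lean document; each statement's English description precedes it below -/
import Mathlib

section
/- Let G be the threshold hypergraph with string 0^{m₁} k₁ 0^{m₂} k₂ ⋯ 0^{m_d} k_d (built from an isolated vertex by adding m₁ isolated vertices, then a k₁-dominating set, then m₂ isolated vertices, then a k₂-dominating set, etc., with m₁ ≥ 1). Then the eigenvalues of L_G are: 0 with multiplicity 1; d − i + 1 with multiplicity m_i for each i = 2, …, d; d with multiplicity m₁ − 1; (1/k_i)(Σ_{j=1}^{i} m_j + Σ_{j=1}^{i} k_j) + d − i with multiplicity 1 for each i = 1, …, d; and ((k_i+1)/k_i)(Σ_{j=1}^{i} m_j + Σ_{j=1}^{i−1} k_j) + d − i with multiplicity k_i − 1 for each i = 1, …, d. -/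
open Finset

/-- The hypergraph Laplacian as an operator on real-valued vertex functions:
`(L_G f)(v) = ∑_{e ∋ v} (1/(|e|-1)) ∑_{u ∈ e} (f v - f u)`. -/
noncomputable def lapOp {V : Type} [Fintype V] [DecidableEq V] (E : Finset (Finset V)) (f : V → ℝ) : V → ℝ :=
  fun v => ∑ e ∈ E.filter (fun e => v ∈ e), (1 / ((e.card : ℝ) - 1)) * ∑ u ∈ e, (f v - f u)

/-- The matrix of the hypergraph Laplacian. -/
noncomputable def lapMatrix {V : Type} [Fintype V] [DecidableEq V] (E : Finset (Finset V)) : Matrix V V ℝ :=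
  Matrix.of fun v w => ∑ e ∈ E.filter (fun e => v ∈ e),
    (1 / ((e.card : ℝ) - 1)) * ((if w = v then (e.card : ℝ) else 0) - (if w ∈ e then 1 else 0))

/-- Edge set obtained from `E` by adding a `k`-dominating set `S = Fin k` of fresh vertices:
the new edges are `S ∪ {u}` for every old vertex `u`. -/
def domEdges {V : Type} [Fintype V] [DecidableEq V] (E : Finset (Finset V)) (k : ℕ) :
    Finset (Finset (V ⊕ Fin k)) :=
  E.image (Finset.image Sum.inl) ∪
    (Finset.univ : Finset V).image
      (fun u => insert (Sum.inl u) ((Finset.univ : Finset (Fin k)).image Sum.inr))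

/-- Vertex type of the threshold hypergraph with string `0^{m 0} (k 0) 0^{m 1} (k 1) ⋯`:
`inl ⟨i, a⟩` is the `a`-th isolated vertex added before the `i`-th domination, and
`inr ⟨i, b⟩` is the `b`-th vertex of the `i`-th dominating set. -/
abbrev TV (d : ℕ) (m k : Fin d → ℕ) : Type :=
  (Σ i : Fin d, Fin (m i)) ⊕ (Σ i : Fin d, Fin (k i))

/-- Vertices present just before the `i`-th domination is applied. -/
def before (d : ℕ) (m k : Fin d → ℕ) (i : Fin d) : Finset (TV d m k) :=
  (((Finset.univ.filter (fun j : Fin d => j ≤ i)).sigma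
      fun j => (Finset.univ : Finset (Fin (m j)))).image Sum.inl) ∪
  (((Finset.univ.filter (fun j : Fin d => j < i)).sigma
      fun j => (Finset.univ : Finset (Fin (k j)))).image Sum.inr)

/-- The `i`-th dominating set. -/
def domSet (d : ℕ) (m k : Fin d → ℕ) (i : Fin d) : Finset (TV d m k) :=
  (Finset.univ : Finset (Fin (k i))).image fun b => Sum.inr ⟨i, b⟩

/-- The edge set of the threshold hypergraph `0^{m 0} (k 0) 0^{m 1} (k 1) ⋯ 0^{m (d-1)} (k (d-1))`:
the `i`-th domination adds the edges `S_i ∪ {u}` for all previously present vertices `u`. -/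
def thrEdges (d : ℕ) (m k : Fin d → ℕ) : Finset (Finset (TV d m k)) :=
  Finset.univ.biUnion fun i : Fin d =>
    (before d m k i).image fun u => insert u (domSet d m k i)

/-- The contribution to the Laplacian matrix of the edges `S ∪ {u}`, `u ∈ B`. -/
noncomputable def domMatrix {V : Type} [DecidableEq V] (B S : Finset V) : Matrix V V ℝ :=
  Matrix.of fun v w => ∑ u ∈ B, if v ∈ insert u S then
    (1 / (S.card : ℝ)) * ((if w = v then (S.card : ℝ) + 1 else 0) - if w ∈ insert u S then 1 else 0)
    else 0

lemma domMatrix_map {V W : Type} [DecidableEq V] [DecidableEq W] (φ : V ↪ W) (B S : Finset V)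
    (v w : V) : domMatrix (B.map φ) (S.map φ) (φ v) (φ w) = domMatrix B S v w := by
  simp [domMatrix]

lemma domMatrix_eq_zero_left {V : Type} [DecidableEq V] {B S : Finset V} {v : V}
    (hB : v ∉ B) (hS : v ∉ S) (w : V) : domMatrix B S v w = 0 := by
  refine Finset.sum_eq_zero fun u hu => ?_
  have : v ≠ u := fun h => hB (h ▸ hu)
  simp [this, hS]

lemma domMatrix_eq_zero_right {V : Type} [DecidableEq V] {B S : Finset V} {w : V}
    (hB : w ∉ B) (hS : w ∉ S) (v : V) : domMatrix B S v w = 0 := by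
  by_cases hvw : w = v
  · exact hvw ▸ domMatrix_eq_zero_left hB hS w
  · refine Finset.sum_eq_zero fun u hu => ?_
    have : w ≠ u := fun h => hB (h ▸ hu)
    simp [this, hS, hvw]

/-- The contribution of a dominating set `K` adjoined to all of `V`, as a block matrix. -/
lemma domMatrix_sum {V K : Type} [Fintype V] [DecidableEq V] [Fintype K] [DecidableEq K]
    (hK : 0 < Fintype.card K) :
    domMatrix ((univ : Finset V).map (.inl : V ↪ V ⊕ K)) ((univ : Finset K).map .inr) =
      Matrix.fromBlocks 1 (Matrix.of fun _ _ => -(1 / (Fintype.card K : ℝ)))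
        (Matrix.of fun _ _ => -(1 / (Fintype.card K : ℝ)))
        (((Fintype.card V : ℝ) * (Fintype.card K + 1) / Fintype.card K) • 1 -
          Matrix.of fun _ _ => (Fintype.card V : ℝ) / Fintype.card K) := by
  have hK' : (Fintype.card K : ℝ) ≠ 0 := by positivity
  ext (v | v) (w | w)
  · by_cases h : w = v
    · subst h
      simp [domMatrix, hK']
    · have h' : v ≠ w := fun h' => h h'.symm
      simp [domMatrix, h, h']
  · simp [domMatrix]
  · simp [domMatrix, Finset.sum_neg_distrib]
  · by_cases h : w = v
    · subst h
      simp [domMatrix]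
      field_simp
      ring
    · have h' : v ≠ w := fun h' => h h'.symm
      simp [domMatrix, h, h']
      field_simp

lemma mem_before_inl {d : ℕ} {m k : Fin d → ℕ} {i : Fin d} (x : Σ i : Fin d, Fin (m i)) :
    (Sum.inl x : TV d m k) ∈ before d m k i ↔ x.1 ≤ i := by
  simp [before]

lemma mem_before_inr {d : ℕ} {m k : Fin d → ℕ} {i : Fin d} (x : Σ i : Fin d, Fin (k i)) :
    (Sum.inr x : TV d m k) ∈ before d m k i ↔ x.1 < i := by
  simp [before]

lemma notMem_domSet_inl {d : ℕ} {m k : Fin d → ℕ} {i : Fin d} (x : Σ i : Fin d, Fin (m i)) :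
    (Sum.inl x : TV d m k) ∉ domSet d m k i := by
  simp [domSet]

lemma mem_domSet_inr {d : ℕ} {m k : Fin d → ℕ} {i : Fin d} (x : Σ i : Fin d, Fin (k i)) :
    (Sum.inr x : TV d m k) ∈ domSet d m k i ↔ x.1 = i := by
  obtain ⟨j, b⟩ := x
  simp only [domSet, mem_image, mem_univ, true_and, Sum.inr.injEq]
  constructor
  · rintro ⟨b', h⟩
    exact (congrArg Sigma.fst h).symm
  · rintro rfl
    exact ⟨b, rfl⟩

lemma notMem_domSet_of_mem_before {d : ℕ} {m k : Fin d → ℕ} {i j : Fin d} (hij : i ≤ j) {u : TV d m k}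
    (hu : u ∈ before d m k i) : u ∉ domSet d m k j := by
  rcases u with u | u
  · exact notMem_domSet_inl u
  · rw [mem_before_inr] at hu
    rw [mem_domSet_inr]
    exact (hu.trans_le hij).ne

lemma insert_domSet_ne {d : ℕ} {m k : Fin d → ℕ} (hk : ∀ i, 1 ≤ k i) {i j : Fin d} (hij : i < j)
    {u u' : TV d m k} (hu : u ∈ before d m k i) :
    insert u (domSet d m k i) ≠ insert u' (domSet d m k j) := by
  intro h
  have hmem : (Sum.inr ⟨j, ⟨0, hk j⟩⟩ : TV d m k) ∈ insert u (domSet d m k i) := by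
    rw [h]
    exact mem_insert_of_mem ((mem_domSet_inr _).2 rfl)
  rcases mem_insert.1 hmem with h' | h'
  · rw [← h', mem_before_inr] at hu
    exact absurd hij hu.asymm
  · exact hij.ne' ((mem_domSet_inr _).1 h')

lemma lapMatrix_thrEdges {d : ℕ} (m k : Fin d → ℕ) (hk : ∀ i, 1 ≤ k i) :
    lapMatrix (thrEdges d m k) = ∑ i, domMatrix (before d m k i) (domSet d m k i) := by
  ext v w
  rw [Matrix.sum_apply, lapMatrix, Matrix.of_apply, sum_filter, thrEdges, sum_biUnion]
  · refine sum_congr rfl fun i _ => ?_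
    rw [sum_image]
    · rw [domMatrix, Matrix.of_apply]
      refine sum_congr rfl fun u hu => ?_
      rw [card_insert_of_notMem (notMem_domSet_of_mem_before le_rfl hu)]
      push_cast
      rw [add_sub_cancel_right]
    · intro u hu u' hu' h
      have : u ∈ insert u' (domSet d m k i) := by
        rw [← show insert u _ = insert u' _ from h]
        exact mem_insert_self _ _
      exact (mem_insert.1 this).resolve_right (notMem_domSet_of_mem_before le_rfl hu)
  · intro i _ j _ hij
    simp only [Function.onFun, disjoint_left, mem_image]
    rintro _ ⟨u, hu, rfl⟩ ⟨u', hu', h⟩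
    rcases lt_or_gt_of_ne hij with hlt | hlt
    · exact insert_domSet_ne hk hlt hu h.symm
    · exact insert_domSet_ne hk hlt hu' h

lemma lapMatrix_row_sum {V : Type} [Fintype V] [DecidableEq V] (E : Finset (Finset V)) (v : V) :
    ∑ w, lapMatrix E v w = 0 := by
  simp only [lapMatrix, Matrix.of_apply]
  rw [sum_comm]
  refine sum_eq_zero fun e _ => ?_
  rw [← mul_sum]
  simp

/-- The vertices of a threshold hypergraph with `d + 1` dominations: those of the hypergraph with
the last round removed, the last isolated vertices, and the last dominating set. -/
def extendVertex {d : ℕ} (m k : Fin (d + 1) → ℕ) :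
    (TV d (fun i => m i.castSucc) (fun i => k i.castSucc) ⊕ Fin (m (Fin.last d))) ⊕
      Fin (k (Fin.last d)) → TV (d + 1) m k
  | .inl (.inl (.inl x)) => .inl ⟨x.1.castSucc, x.2⟩
  | .inl (.inl (.inr x)) => .inr ⟨x.1.castSucc, x.2⟩
  | .inl (.inr a) => .inl ⟨Fin.last d, a⟩
  | .inr b => .inr ⟨Fin.last d, b⟩

lemma extendVertex_bijective {d : ℕ} (m k : Fin (d + 1) → ℕ) :
    Function.Bijective (extendVertex m k) := by
  constructor
  · rintro (((⟨i, a⟩ | ⟨i, a⟩) | a) | a) (((⟨j, b⟩ | ⟨j, b⟩) | b) | b) h <;>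
      simp only [extendVertex, Sum.inl.injEq, Sum.inr.injEq, reduceCtorEq, Sigma.mk.injEq,
        Fin.castSucc_inj, heq_eq_eq, true_and, (Fin.castSucc_lt_last _).ne,
        (Fin.castSucc_lt_last _).ne', false_and] at h ⊢ <;>
      exact h
  · rintro (⟨i, a⟩ | ⟨i, a⟩)
    · induction i using Fin.lastCases with
      | last => exact ⟨.inl (.inr a), rfl⟩
      | cast i => exact ⟨.inl (.inl (.inl ⟨i, a⟩)), rfl⟩
    · induction i using Fin.lastCases with
      | last => exact ⟨.inr a, rfl⟩
      | cast i => exact ⟨.inl (.inl (.inr ⟨i, a⟩)), rfl⟩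

/-- `extendVertex` as an equivalence. -/
noncomputable def extendEquiv {d : ℕ} (m k : Fin (d + 1) → ℕ) :
    (TV d (fun i => m i.castSucc) (fun i => k i.castSucc) ⊕ Fin (m (Fin.last d))) ⊕
      Fin (k (Fin.last d)) ≃ TV (d + 1) m k :=
  Equiv.ofBijective _ (extendVertex_bijective m k)

lemma before_castSucc {d : ℕ} (m k : Fin (d + 1) → ℕ) (i : Fin d) :
    before (d + 1) m k i.castSucc =
      (((before d _ _ i).map .inl).map .inl).map (extendEquiv m k).toEmbedding := by
  ext x
  obtain ⟨y, rfl⟩ := (extendEquiv m k).surjective x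
  rw [← Equiv.coe_toEmbedding, mem_map']
  rcases y with ((y | y) | y) | y <;>
    simp [extendEquiv, extendVertex, mem_before_inl, mem_before_inr, Fin.le_last, -Sigma.exists]

lemma domSet_castSucc {d : ℕ} (m k : Fin (d + 1) → ℕ) (i : Fin d) :
    domSet (d + 1) m k i.castSucc =
      (((domSet d _ _ i).map .inl).map .inl).map (extendEquiv m k).toEmbedding := by
  ext x
  obtain ⟨y, rfl⟩ := (extendEquiv m k).surjective x
  rw [← Equiv.coe_toEmbedding, mem_map']
  rcases y with ((y | y) | y) | y <;>
    simp [extendEquiv, extendVertex, notMem_domSet_inl, mem_domSet_inr, (Fin.castSucc_lt_last _).ne',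
      -Sigma.exists]

lemma before_last {d : ℕ} (m k : Fin (d + 1) → ℕ) :
    before (d + 1) m k (Fin.last d) =
      (univ.map .inl).map (extendEquiv m k).toEmbedding := by
  ext x
  obtain ⟨y, rfl⟩ := (extendEquiv m k).surjective x
  rw [← Equiv.coe_toEmbedding, mem_map']
  rcases y with ((y | y) | y) | y <;>
    simp [extendEquiv, extendVertex, mem_before_inl, mem_before_inr, Fin.le_last,
      Fin.castSucc_lt_last]

lemma domSet_last {d : ℕ} (m k : Fin (d + 1) → ℕ) :
    domSet (d + 1) m k (Fin.last d) =
      (univ.map .inr).map (extendEquiv m k).toEmbedding := by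
  ext x
  obtain ⟨y, rfl⟩ := (extendEquiv m k).surjective x
  rw [← Equiv.coe_toEmbedding, mem_map']
  rcases y with ((y | y) | y) | y <;>
    simp [extendEquiv, extendVertex, notMem_domSet_inl, mem_domSet_inr, (Fin.castSucc_lt_last _).ne]

lemma domMatrix_map_inl {V W : Type} [DecidableEq V] [DecidableEq W] (B S : Finset V) :
    domMatrix (B.map (.inl : V ↪ V ⊕ W)) (S.map .inl) =
      Matrix.fromBlocks (domMatrix B S) 0 0 0 := by
  ext (v | v) (w | w)
  · exact domMatrix_map .inl B S v w
  · exact domMatrix_eq_zero_right (by simp) (by simp) _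
  · exact domMatrix_eq_zero_left (by simp) (by simp) _
  · exact domMatrix_eq_zero_left (by simp) (by simp) _

lemma lapMatrix_thrEdges_succ {d : ℕ} (m k : Fin (d + 1) → ℕ) (hk : ∀ i, 1 ≤ k i) :
    (lapMatrix (thrEdges (d + 1) m k)).submatrix (extendEquiv m k) (extendEquiv m k) =
      Matrix.fromBlocks (Matrix.fromBlocks
          (lapMatrix (thrEdges d (fun i => m i.castSucc) (fun i => k i.castSucc))) 0 0 0) 0 0 0 +
        domMatrix (univ.map .inl) (univ.map .inr) := by
  rw [lapMatrix_thrEdges m k hk, lapMatrix_thrEdges _ _ fun i => hk i.castSucc,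
    Fin.sum_univ_castSucc]
  have hsub (B S : Finset _) : (domMatrix (B.map (extendEquiv m k).toEmbedding)
      (S.map (extendEquiv m k).toEmbedding)).submatrix (extendEquiv m k) (extendEquiv m k) =
      domMatrix B S := by
    ext v w
    exact domMatrix_map _ B S v w
  simp only [before_castSucc, domSet_castSucc, before_last, domSet_last, Matrix.submatrix_add,
    Pi.add_apply, hsub]
  congr 1
  ext v w
  simp only [Matrix.submatrix_apply, Matrix.sum_apply]
  simp only [← Matrix.submatrix_apply, hsub, domMatrix_map_inl]
  rcases v with (v | v) | v <;> rcases w with (w | w) | w <;> simp [Matrix.sum_apply]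

lemma det_smul_one_sub_const {K : Type} [Fintype K] [DecidableEq K] {a : ℝ} (ha : a ≠ 0) (b : ℝ) :
    (a • (1 : Matrix K K ℝ) - Matrix.of fun _ _ => b).det =
      a ^ Fintype.card K * (1 - Fintype.card K * b / a) := by
  have h : a • (1 : Matrix K K ℝ) - Matrix.of (fun _ _ => b) =
      a • (1 + Matrix.replicateCol Unit (fun _ => -b / a) *
        Matrix.replicateRow Unit (fun _ => (1 : ℝ))) := by
    ext v w
    simp [Matrix.mul_apply, Matrix.one_apply, mul_add]
    field_simp
    ring
  rw [h, Matrix.det_smul, Matrix.det_one_add_replicateCol_mul_replicateRow]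
  simp [dotProduct]
  left
  ring

/-- Effect of adjoining a dominating set `K` to `V` on the characteristic polynomial of a matrix
with zero row sums. -/
lemma eval_charpoly_dominate {V K : Type} [Fintype V] [DecidableEq V] [Fintype K] [DecidableEq K]
    (hK : 0 < Fintype.card K) (M : Matrix V V ℝ) (hM : ∀ v, ∑ w, M v w = 0) {x : ℝ}
    (hx : x ≠ 1) (hdet : M.charpoly.eval (x - 1) ≠ 0)
    (hxb : x ≠ (Fintype.card V : ℝ) * (Fintype.card K + 1) / Fintype.card K) :
    (Matrix.fromBlocks M 0 0 0 +
      domMatrix ((univ : Finset V).map (.inl : V ↪ V ⊕ K)) (univ.map .inr)).charpoly.eval x *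
        (x - 1) =
      M.charpoly.eval (x - 1) * (x * (x - 1 - Fintype.card V / Fintype.card K) *
        (x - (Fintype.card V : ℝ) * (Fintype.card K + 1) / Fintype.card K) ^
          (Fintype.card K - 1)) := by
  have hK' : (Fintype.card K : ℝ) ≠ 0 := by positivity
  have hx1 : x - 1 ≠ 0 := sub_ne_zero.2 hx
  have hxb' := sub_ne_zero.2 hxb
  rw [Matrix.eval_charpoly] at hdet
  simp only [Matrix.eval_charpoly]
  set n : ℝ := (Fintype.card V : ℝ) with hn
  set k : ℝ := (Fintype.card K : ℝ) with hk
  set A := Matrix.scalar V (x - 1) - M with hA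
  let := A.invertibleOfIsUnitDet hdet.isUnit
  set U : Matrix V K ℝ := Matrix.of fun _ _ => 1 / k with hU
  set W : Matrix K V ℝ := Matrix.of fun _ _ => 1 / k with hW
  have hAB : A * U =
      (x - 1) • U := by
    ext v w
    rw [hA, Matrix.sub_mul, Matrix.sub_apply, Matrix.mul_apply, Matrix.mul_apply]
    simp [hU, Matrix.diagonal_apply, ← Finset.sum_mul, hM]
  have hinv : ⅟A * U =
      (x - 1)⁻¹ • U := by
    have := congrArg (fun N => (x - 1)⁻¹ • (⅟A * N)) hAB
    simp only [Matrix.mul_smul, smul_smul, inv_mul_cancel₀ hx1, one_smul] at this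
    rw [← this, ← Matrix.mul_assoc, invOf_mul_self, Matrix.one_mul]
  have hblock : Matrix.scalar (V ⊕ K) x - (Matrix.fromBlocks M 0 0 0 +
      domMatrix ((univ : Finset V).map (.inl : V ↪ V ⊕ K)) (univ.map .inr)) =
      Matrix.fromBlocks A U W
        ((x - n * (k + 1) / k) • 1 - Matrix.of fun _ _ => -(n / k)) := by
    rw [domMatrix_sum hK]
    ext (v | v) (w | w) <;>
      simp [hA, hU, hW, Matrix.diagonal_apply, Matrix.one_apply, ← hn, ← hk] <;> split_ifs <;> ring
  have hschur : ((x - n * (k + 1) / k) • 1 - Matrix.of fun _ _ => -(n / k)) -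
      W * ⅟A * U =
      (x - n * (k + 1) / k) • (1 : Matrix K K ℝ) -
        Matrix.of fun _ _ => -(n / k) + n / (k * k * (x - 1)) := by
    rw [Matrix.mul_assoc, hinv]
    ext v w
    simp [hU, hW, Matrix.mul_apply, ← hn]
    field_simp
    ring
  rw [hblock, Matrix.det_fromBlocks₁₁, hschur, det_smul_one_sub_const hxb', mul_assoc]
  congr 1
  obtain ⟨l, hl⟩ := Nat.exists_eq_succ_of_ne_zero hK.ne'
  rw [← hk, hl, Nat.succ_sub_one, pow_succ]
  have : (x - n * (k + 1) / k) * (1 - k * (-(n / k) + n / (k * k * (x - 1))) /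
      (x - n * (k + 1) / k)) * (x - 1) = x * (x - 1 - n / k) := by
    rw [mul_one_sub, mul_div_cancel₀ _ hxb']
    field_simp
    ring
  rw [← this]
  ring

lemma charpoly_thrEdges_eval_succ {d : ℕ} (m k : Fin (d + 1) → ℕ) (hk : ∀ i, 1 ≤ k i) {n : ℝ}
    (hn : n = ∑ i, (m i : ℝ) + ∑ i : Fin d, (k i.castSucc : ℝ)) {x : ℝ}
    (hx : x ≠ 1) (hdet : (lapMatrix (thrEdges d (fun i => m i.castSucc)
      (fun i => k i.castSucc))).charpoly.eval (x - 1) ≠ 0)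
    (hxb : x ≠ n * (k (Fin.last d) + 1) / k (Fin.last d)) :
    (lapMatrix (thrEdges (d + 1) m k)).charpoly.eval x * (x - 1) =
      (lapMatrix (thrEdges d (fun i => m i.castSucc) (fun i => k i.castSucc))).charpoly.eval (x - 1) *
        (x - 1) ^ m (Fin.last d) * (x * (x - 1 - n / k (Fin.last d)) *
          (x - n * (k (Fin.last d) + 1) / k (Fin.last d)) ^ (k (Fin.last d) - 1)) := by
  set M := lapMatrix (thrEdges d (fun i => m i.castSucc) (fun i => k i.castSucc)) with hM
  have hcard : (Fintype.card (TV d (fun i => m i.castSucc) (fun i => k i.castSucc) ⊕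
      Fin (m (Fin.last d))) : ℝ) = n := by
    rw [hn, Fin.sum_univ_castSucc]
    simp
    ring
  have hpoly : (Matrix.fromBlocks M 0 0 (0 : Matrix (Fin (m (Fin.last d))) _ ℝ)).charpoly =
      M.charpoly * Polynomial.X ^ m (Fin.last d) := by
    rw [Matrix.charpoly_fromBlocks_zero₁₂, Matrix.charpoly_zero, Fintype.card_fin]
  have hreindex : (lapMatrix (thrEdges (d + 1) m k)).charpoly =
      (Matrix.fromBlocks (Matrix.fromBlocks M 0 0 (0 : Matrix (Fin (m (Fin.last d))) _ ℝ)) 0 0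
          (0 : Matrix (Fin (k (Fin.last d))) _ ℝ) +
        domMatrix (univ.map .inl) (univ.map .inr)).charpoly := by
    rw [← lapMatrix_thrEdges_succ m k hk, ← Matrix.charpoly_reindex (extendEquiv m k).symm]
    rfl
  rw [hreindex]
  have := eval_charpoly_dominate (K := Fin (k (Fin.last d)))
    (by simpa using Nat.pos_of_ne_zero (Nat.one_le_iff_ne_zero.1 (hk _)))
    (Matrix.fromBlocks M 0 0 (0 : Matrix (Fin (m (Fin.last d))) _ ℝ))
    (by rintro (v | v) <;> simp [hM, lapMatrix_row_sum]) hx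
    (by
      rw [hpoly]
      simp only [Polynomial.eval_mul, Polynomial.eval_pow, Polynomial.eval_X]
      exact mul_ne_zero hdet (pow_ne_zero _ (sub_ne_zero.2 hx)))
    (by rwa [hcard, Fintype.card_fin])
  rw [this, hpoly, hcard]
  simp

lemma sum_filter_le_castSucc {d : ℕ} (f : Fin (d + 1) → ℝ) (i : Fin d) :
    ∑ j ∈ univ.filter (· ≤ i.castSucc), f j = ∑ j ∈ univ.filter (· ≤ i), f j.castSucc := by
  simp [sum_filter, Fin.sum_univ_castSucc]

lemma sum_filter_lt_castSucc {d : ℕ} (f : Fin (d + 1) → ℝ) (i : Fin d) :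
    ∑ j ∈ univ.filter (· < i.castSucc), f j = ∑ j ∈ univ.filter (· < i), f j.castSucc := by
  simp [sum_filter, Fin.sum_univ_castSucc, (Fin.castSucc_lt_last i).not_gt]

lemma sum_filter_lt_last {d : ℕ} (f : Fin (d + 1) → ℝ) :
    ∑ j ∈ univ.filter (· < Fin.last d), f j = ∑ j : Fin d, f j.castSucc := by
  simp [sum_filter, Fin.sum_univ_castSucc, Fin.castSucc_lt_last]

open Polynomial in
lemma charpoly_thrEdges_mul {d : ℕ} (m k : Fin d → ℕ) (hk : ∀ i, 1 ≤ k i) :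
    (lapMatrix (thrEdges d m k)).charpoly * (X - C (d : ℝ)) =
      X * ((∏ i : Fin d, (X - C ((d : ℝ) - i.val)) ^ m i) *
        (∏ i : Fin d, (X - C ((1 / (k i : ℝ)) *
              ((∑ j ∈ Finset.univ.filter (fun j : Fin d => j ≤ i), (m j : ℝ)) +
                ∑ j ∈ Finset.univ.filter (fun j : Fin d => j ≤ i), (k j : ℝ)) +
            ((d : ℝ) - (i.val + 1))))) *
        ∏ i : Fin d, (X - C (((k i : ℝ) + 1) / (k i : ℝ) *
                ((∑ j ∈ Finset.univ.filter (fun j : Fin d => j ≤ i), (m j : ℝ)) +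
                  ∑ j ∈ Finset.univ.filter (fun j : Fin d => j < i), (k j : ℝ)) +
              ((d : ℝ) - (i.val + 1)))) ^ (k i - 1)) := by
  induction d with
  | zero => simp [Matrix.charpoly]
  | succ d ih =>
    set M := lapMatrix (thrEdges d (fun i => m i.castSucc) (fun i => k i.castSucc)) with hM
    set n : ℝ := ∑ i, (m i : ℝ) + ∑ i : Fin d, (k i.castSucc : ℝ) with hn
    have hfin : ({1} ∪ {n * (k (Fin.last d) + 1) / k (Fin.last d)} ∪
        (M.charpoly.comp (X - C 1)).rootSet ℝ).Finite :=
      ((Set.finite_singleton _).union (Set.finite_singleton _)).union (rootSet_finite _ _)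
    refine eq_of_infinite_eval_eq _ _ (hfin.infinite_compl.mono fun x hx => ?_)
    have hmonic : (M.charpoly.comp (X - C 1)).Monic := (Matrix.charpoly_monic M).comp_X_sub_C 1
    simp only [Set.mem_compl_iff, Set.mem_union, Set.mem_singleton_iff, mem_rootSet,
      hmonic.ne_zero, not_or, aeval_def, eval₂_eq_eval_map, eval_comp, Polynomial.map_comp,
      Algebra.algebraMap_self, Polynomial.map_id, ne_eq, not_false_eq_true, true_and, eval_sub,
      eval_X, eval_C] at hx
    obtain ⟨⟨hx1, hxb⟩, hdet⟩ := hx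
    have hx1' : x - 1 ≠ 0 := sub_ne_zero.2 hx1
    have hk0 : (k (Fin.last d) : ℝ) ≠ 0 := by have := hk (Fin.last d); positivity
    have hstep := charpoly_thrEdges_eval_succ m k hk hn hx1 hdet hxb
    have hih := congrArg (eval (x - 1))
      (ih (fun i => m i.castSucc) (fun i => k i.castSucc) fun i => hk i.castSucc)
    simp only [Set.mem_ofPred_eq, eval_mul, eval_sub, eval_X, eval_C, eval_prod, eval_pow]
      at hih ⊢
    apply mul_right_cancel₀ hx1'
    rw [mul_right_comm, hstep]
    have hsucc (a b : ℝ) : x - (a + ((d : ℝ) + 1 - b)) = x - 1 - (a + (d - b)) := by ring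
    have hsucc' (b : ℝ) : x - ((d : ℝ) + 1 - b) = x - 1 - (d - b) := by ring
    simp only [Fin.prod_univ_castSucc, sum_filter_le_castSucc, sum_filter_lt_castSucc,
      sum_filter_lt_last, Fin.val_castSucc, Fin.val_last, Nat.cast_add, Nat.cast_one, hsucc,
      hsucc', Fin.le_last, filter_true]
    rw [Fin.sum_univ_castSucc (fun i => (k i : ℝ)), ← add_assoc, ← hn]
    have ha : x - 1 - (1 / (k (Fin.last d) : ℝ) * (n + k (Fin.last d)) + ((d : ℝ) - (d + 1))) =
        x - 1 - n / k (Fin.last d) := by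
      field_simp
      ring
    have hb : x - 1 - (((k (Fin.last d) : ℝ) + 1) / k (Fin.last d) * n + ((d : ℝ) - (d + 1))) =
        x - n * (k (Fin.last d) + 1) / k (Fin.last d) := by
      ring
    rw [ha, hb, sub_self, sub_zero]
    linear_combination ((x - 1) ^ m (Fin.last d) * (x * (x - 1 - n / k (Fin.last d)) *
      (x - n * (k (Fin.last d) + 1) / k (Fin.last d)) ^ (k (Fin.last d) - 1))) * hih

/-- The complete Laplacian spectrum of the threshold hypergraph
`0^{m₁} k₁ 0^{m₂} k₂ ⋯ 0^{m_d} k_d` (here `0`-indexed: `m i, k i` for `i : Fin d`). -/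
theorem stmt_6 (d : ℕ) (hd : 0 < d) (m k : Fin d → ℕ)
    (hm : 1 ≤ m ⟨0, hd⟩) (hk : ∀ i, 1 ≤ k i) :
    (lapMatrix (thrEdges d m k)).charpoly.roots =
      ((0 : ℝ) ::ₘ
        (Finset.univ.val.bind fun i : Fin d =>
          Multiset.replicate (if i.val = 0 then m i - 1 else m i) ((d : ℝ) - i.val)))
      + (Finset.univ.val.bind fun i : Fin d =>
          {(1 / (k i : ℝ)) *
              ((∑ j ∈ Finset.univ.filter (fun j : Fin d => j ≤ i), (m j : ℝ)) +
                ∑ j ∈ Finset.univ.filter (fun j : Fin d => j ≤ i), (k j : ℝ)) +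
            ((d : ℝ) - (i.val + 1))})
      + (Finset.univ.val.bind fun i : Fin d =>
          Multiset.replicate (k i - 1)
            (((k i : ℝ) + 1) / (k i : ℝ) *
                ((∑ j ∈ Finset.univ.filter (fun j : Fin d => j ≤ i), (m j : ℝ)) +
                  ∑ j ∈ Finset.univ.filter (fun j : Fin d => j < i), (k j : ℝ)) +
              ((d : ℝ) - (i.val + 1)))) := by
  have hroots (s : Multiset ℝ) (h : (lapMatrix (thrEdges d m k)).charpoly =
      (s.map fun a => Polynomial.X - Polynomial.C a).prod) :
      (lapMatrix (thrEdges d m k)).charpoly.roots = s := by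
    rw [h, Polynomial.roots_multiset_prod_X_sub_C]
  apply hroots
  apply mul_right_cancel₀ (Polynomial.X_sub_C_ne_zero (d : ℝ))
  rw [charpoly_thrEdges_mul m k hk]
  have hisol : ∏ i : Fin d, (Polynomial.X - Polynomial.C ((d : ℝ) - i.val)) ^ m i =
      (∏ i : Fin d, (Polynomial.X - Polynomial.C ((d : ℝ) - i.val)) ^
        (if i.val = 0 then m i - 1 else m i)) *
        (Polynomial.X - Polynomial.C (d : ℝ)) := by
    obtain ⟨d, rfl⟩ := Nat.exists_eq_succ_of_ne_zero hd.ne'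
    rw [Fin.prod_univ_succ, Fin.prod_univ_succ, mul_right_comm]
    congr 1
    simp [← pow_succ, Nat.sub_add_cancel (show 1 ≤ m 0 from hm)]
  simp only [Multiset.map_add, Multiset.map_cons, Multiset.prod_add, Multiset.prod_cons,
    Multiset.map_bind, Multiset.prod_bind, Multiset.map_replicate, Multiset.prod_replicate,
    Multiset.map_singleton, Multiset.prod_singleton, map_zero, sub_zero, hisol,
    Finset.prod_map_val]
  ring
end

section
/- Let G be the k-threshold hypergraph with string 0^{m₁} k 0^{m₂} k ⋯ 0^{m_d} k (every domination is a k-domination). Then the Laplacian eigenvalues of G are: 0 with multiplicity 1; d − i + 1 with multiplicity m_i for each i = 2, …, d; d with multiplicity m₁ − 1; (1/k) Σ_{j=1}^{i} m_j + d with multiplicity 1 for each i = 1, …, d; and ((k+1)/k) Σ_{j=1}^{i} m_j + k(i−1) + d − 1 with multiplicity k − 1 for each i = 1, …, d. -/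
open Finset

lemma Matrix.charpoly_roots_of_mul_eq_mul_diagonal {V : Type*} [Fintype V] [DecidableEq V]
    (M P : Matrix V V ℝ) (lam : V → ℝ) (hP : P.det ≠ 0) (h : M * P = P * Matrix.diagonal lam) :
    M.charpoly.roots = Finset.univ.val.map lam := by
  have hu : IsUnit P := (Matrix.isUnit_iff_isUnit_det P).2 hP.isUnit
  obtain ⟨U, rfl⟩ := hu
  have hM : M = U.val * Matrix.diagonal lam * U⁻¹.val := by
    rw [← h, mul_assoc, Units.mul_inv, mul_one]
  rw [hM, Matrix.coe_units_inv, Matrix.charpoly_units_conj, Matrix.charpoly_diagonal]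
  have h2 := Polynomial.roots_multiset_prod_X_sub_C (Finset.univ.val.map lam)
  rwa [Multiset.map_map] at h2

lemma lapMatrix_mulVec {V : Type} [Fintype V] [DecidableEq V] (E : Finset (Finset V)) (f : V → ℝ)
    (v : V) : (lapMatrix E).mulVec f v =
      ∑ e ∈ E, if v ∈ e then (1 / ((e.card : ℝ) - 1)) * (e.card * f v - ∑ u ∈ e, f u) else 0 := by
  simp only [lapMatrix, Matrix.mulVec, dotProduct, Matrix.of_apply, Finset.sum_mul]
  rw [Finset.sum_comm, Finset.sum_filter]
  refine Finset.sum_congr rfl fun e _ => ?_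
  split_ifs with h
  · simp only [mul_assoc, ← Finset.mul_sum, sub_mul, ite_mul, zero_mul, one_mul,
      Finset.sum_sub_distrib]
    simp
  · rfl

section Threshold

variable {d : ℕ} {m : Fin d → ℕ} {k : ℕ}

lemma inl_mem_before {i j : Fin d} {a : Fin (m i)} :
    (Sum.inl ⟨i, a⟩ : TV d m fun _ => k) ∈ before d m (fun _ => k) j ↔ i ≤ j := by
  simp [before]

lemma inr_mem_before {i j : Fin d} {b : Fin k} :
    (Sum.inr ⟨i, b⟩ : TV d m fun _ => k) ∈ before d m (fun _ => k) j ↔ i < j := by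
  simp [before]

lemma inl_not_mem_domSet {i j : Fin d} {a : Fin (m i)} :
    (Sum.inl ⟨i, a⟩ : TV d m fun _ => k) ∉ domSet d m (fun _ => k) j := by
  simp [domSet]

lemma inr_mem_domSet {i j : Fin d} {b : Fin k} :
    (Sum.inr ⟨i, b⟩ : TV d m fun _ => k) ∈ domSet d m (fun _ => k) j ↔ i = j := by
  simp only [domSet, mem_image, mem_univ, true_and, Sum.inr.injEq, Sigma.mk.injEq]
  constructor
  · rintro ⟨a, rfl, -⟩; rfl
  · rintro rfl; exact ⟨b, rfl, HEq.rfl⟩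

lemma card_domSet (i : Fin d) : (domSet d m (fun _ => k) i).card = k := by
  rw [domSet, Finset.card_image_of_injective _ (fun a b h => by simpa using h)]
  simp

lemma card_before (i : Fin d) : ((before d m (fun _ => k) i).card : ℝ) =
    (∑ j ∈ Finset.univ.filter (fun j : Fin d => j ≤ i), (m j : ℝ)) + k * i.val := by
  rw [before, Finset.card_union_of_disjoint, Finset.card_image_of_injective _ Sum.inl_injective,
    Finset.card_image_of_injective _ Sum.inr_injective]
  · have : (Finset.univ.filter (fun j : Fin d => j < i)).card = i.val := by
      rw [show Finset.univ.filter (fun j : Fin d => j < i) = Finset.Iio i by ext; simp]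
      simp
    simp [this, mul_comm]
  · rw [Finset.disjoint_left]
    simp

/-- The contribution of the `j`-th domination to the Laplacian. -/
noncomputable def dominationLaplacian (j : Fin d) (f : TV d m (fun _ => k) → ℝ)
    (v : TV d m fun _ => k) : ℝ :=
  if v ∈ domSet d m (fun _ => k) j then
    (1 / (k : ℝ)) * ((before d m (fun _ => k) j).card *
      ((k + 1) * f v - ∑ u ∈ domSet d m (fun _ => k) j, f u) - ∑ u ∈ before d m (fun _ => k) j, f u)
  else if v ∈ before d m (fun _ => k) j then
    f v - (1 / (k : ℝ)) * ∑ u ∈ domSet d m (fun _ => k) j, f u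
  else 0

lemma disjoint_before_domSet (j : Fin d) :
    Disjoint (before d m (fun _ => k) j) (domSet d m (fun _ => k) j) := by
  rw [Finset.disjoint_left]
  rintro (⟨i, a⟩ | ⟨i, b⟩) h
  · exact inl_not_mem_domSet
  · rw [inr_mem_domSet]; exact (inr_mem_before.1 h).ne

lemma sum_thrEdges (hk : 1 ≤ k) (g : Finset (TV d m fun _ => k) → ℝ) :
    ∑ e ∈ thrEdges d m (fun _ => k), g e =
      ∑ j, ∑ u ∈ before d m (fun _ => k) j, g (insert u (domSet d m (fun _ => k) j)) := by
  have key : ∀ i j : Fin d, ∀ u ∈ before d m (fun _ => k) i, ∀ u' ∈ before d m (fun _ => k) j,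
      insert u (domSet d m (fun _ => k) i) = insert u' (domSet d m (fun _ => k) j) → j ≤ i := by
    intro i j u hu u' _ h
    have h1 : (Sum.inr ⟨j, ⟨0, hk⟩⟩ : TV d m fun _ => k) ∈ insert u (domSet d m (fun _ => k) i) := by
      rw [h]; exact Finset.mem_insert_of_mem (inr_mem_domSet.2 rfl)
    rcases Finset.mem_insert.1 h1 with rfl | h2
    · exact (inr_mem_before.1 hu).le
    · exact (inr_mem_domSet.1 h2).le
  rw [thrEdges, Finset.sum_biUnion]
  · refine Finset.sum_congr rfl fun j _ => Finset.sum_image ?_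
    intro u hu u' hu' h
    have h1 : u ∈ insert u' (domSet d m (fun _ => k) j) := by
      have h' : insert u (domSet d m (fun _ => k) j) = insert u' (domSet d m (fun _ => k) j) := h
      rw [← h']; exact Finset.mem_insert_self _ _
    exact (Finset.mem_insert.1 h1).resolve_right
      (Finset.disjoint_left.1 (disjoint_before_domSet j) hu)
  · intro i _ j _ hij
    rw [Function.onFun, Finset.disjoint_left]
    intro e he he'
    obtain ⟨u, hu, rfl⟩ := Finset.mem_image.1 he
    obtain ⟨u', hu', h⟩ := Finset.mem_image.1 he'
    exact hij (le_antisymm (key j i u' hu' u hu h) (key i j u hu u' hu' h.symm))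

lemma lapMatrix_thrEdges_mulVec (hk : 1 ≤ k) (f : TV d m (fun _ => k) → ℝ)
    (v : TV d m fun _ => k) :
    (lapMatrix (thrEdges d m fun _ => k)).mulVec f v = ∑ j, dominationLaplacian j f v := by
  have hk0 : (k : ℝ) ≠ 0 := by positivity
  rw [lapMatrix_mulVec, sum_thrEdges hk]
  refine Finset.sum_congr rfl fun j _ => ?_
  have hdis := Finset.disjoint_left.1 (disjoint_before_domSet (m := m) (k := k) j)
  have hcard : ∀ u ∈ before d m (fun _ => k) j,
      ((insert u (domSet d m (fun _ => k) j)).card : ℝ) = k + 1 := fun u hu => by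
    rw [Finset.card_insert_of_notMem (hdis hu), card_domSet]; simp
  have hsum : ∀ u ∈ before d m (fun _ => k) j,
      ∑ w ∈ insert u (domSet d m (fun _ => k) j), f w =
        f u + ∑ w ∈ domSet d m (fun _ => k) j, f w := fun u hu =>
    Finset.sum_insert (hdis hu)
  unfold dominationLaplacian
  split_ifs with h1 h2
  · have : ∀ u ∈ before d m (fun _ => k) j,
        (if v ∈ insert u (domSet d m (fun _ => k) j) then
          (1 / (((insert u (domSet d m (fun _ => k) j)).card : ℝ) - 1)) *
            ((insert u (domSet d m (fun _ => k) j)).card * f v -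
              ∑ w ∈ insert u (domSet d m (fun _ => k) j), f w) else 0) = (1 / (k : ℝ)) *
        ((k + 1) * f v - ∑ w ∈ domSet d m (fun _ => k) j, f w - f u) := fun u hu => by
      rw [if_pos (Finset.mem_insert_of_mem h1), hcard u hu, hsum u hu]; ring
    rw [Finset.sum_congr rfl this, ← Finset.mul_sum, Finset.sum_sub_distrib, Finset.sum_const,
      nsmul_eq_mul]
  · rw [Finset.sum_eq_single_of_mem v h2]
    · rw [if_pos (Finset.mem_insert_self _ _), hcard v h2, hsum v h2, add_sub_cancel_right]
      field_simp
      ring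
    · intro u _ hu
      rw [if_neg]
      rw [Finset.mem_insert, not_or]
      exact ⟨hu.symm, h1⟩
  · refine Finset.sum_eq_zero fun u hu => if_neg ?_
    rw [Finset.mem_insert, not_or]
    exact ⟨fun h => h2 (h ▸ hu), h1⟩

lemma dominationLaplacian_eq_self {j : Fin d} {f : TV d m (fun _ => k) → ℝ}
    (hS : ∀ u ∈ domSet d m (fun _ => k) j, f u = 0)
    (hB : ∀ u ∉ before d m (fun _ => k) j, f u = 0)
    (hsum : ∑ u ∈ before d m (fun _ => k) j, f u = 0) (v : TV d m fun _ => k) :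
    dominationLaplacian j f v = f v := by
  rw [dominationLaplacian, hsum, Finset.sum_eq_zero hS]
  split_ifs with h1 h2
  · simp [hS v h1]
  · simp
  · exact (hB v h2).symm

lemma dominationLaplacian_eq_zero (hk : 1 ≤ k) {j : Fin d} {f : TV d m (fun _ => k) → ℝ} (c : ℝ)
    (hS : ∀ u ∈ domSet d m (fun _ => k) j, f u = c)
    (hB : ∀ u ∈ before d m (fun _ => k) j, f u = c) (v : TV d m fun _ => k) :
    dominationLaplacian j f v = 0 := by
  have hk0 : (k : ℝ) ≠ 0 := by positivity
  rw [dominationLaplacian, Finset.sum_congr rfl hS, Finset.sum_congr rfl hB]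
  simp only [Finset.sum_const, card_domSet, nsmul_eq_mul]
  split_ifs with h1 h2
  · rw [hS v h1]; ring
  · rw [hB v h2]; field_simp; ring
  · rfl

lemma dominationLaplacian_eq_of_supported {j : Fin d} {f : TV d m (fun _ => k) → ℝ}
    (hS : ∀ u ∉ domSet d m (fun _ => k) j, f u = 0)
    (hsum : ∑ u ∈ domSet d m (fun _ => k) j, f u = 0) (v : TV d m fun _ => k) :
    dominationLaplacian j f v = (before d m (fun _ => k) j).card * (k + 1) / k * f v := by
  have hB : ∑ u ∈ before d m (fun _ => k) j, f u = 0 := Finset.sum_eq_zero fun u hu =>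
    hS u (Finset.disjoint_left.1 (disjoint_before_domSet j) hu)
  rw [dominationLaplacian, hsum, hB]
  split_ifs with h1 h2
  · ring
  · rw [hS v h1]; simp
  · rw [hS v h1]; simp

/-- The batch (isolated vertices together with the following dominating set) of a vertex. -/
def batch (v : TV d m fun _ => k) : Fin d := Sum.elim Sigma.fst Sigma.fst v

/-- The function which is constant on a dominating set and on the vertices preceding it, with
total sum zero. -/
noncomputable def dominationVec (i : Fin d) (w : TV d m fun _ => k) : ℝ :=
  (before d m (fun _ => k) i).card * (if w ∈ domSet d m (fun _ => k) i then 1 else 0) -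
    k * (if w ∈ before d m (fun _ => k) i then 1 else 0)

lemma dominationLaplacian_dominationVec (hk : 1 ≤ k) (j : Fin d) (v : TV d m fun _ => k) :
    dominationLaplacian j (dominationVec j) v =
      ((before d m (fun _ => k) j).card / k + 1) * dominationVec j v := by
  have hk0 : (k : ℝ) ≠ 0 := by positivity
  have hdis := disjoint_before_domSet (m := m) (k := k) j
  have h1 : ∑ u ∈ domSet d m (fun _ => k) j, dominationVec j u =
      k * (before d m (fun _ => k) j).card := by
    simp only [dominationVec, Finset.sum_sub_distrib, ← Finset.mul_sum, Finset.sum_boole,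
      Finset.filter_mem_eq_inter, Finset.inter_self, card_domSet]
    rw [Finset.disjoint_iff_inter_eq_empty.1 hdis.symm]
    simp [mul_comm]
  have h2 : ∑ u ∈ before d m (fun _ => k) j, dominationVec j u =
      - k * (before d m (fun _ => k) j).card := by
    simp only [dominationVec, Finset.sum_sub_distrib, ← Finset.mul_sum, Finset.sum_boole,
      Finset.filter_mem_eq_inter, Finset.inter_self]
    rw [Finset.disjoint_iff_inter_eq_empty.1 hdis]
    simp
  rw [dominationLaplacian, h1, h2]
  split_ifs with h3 h4
  · simp only [dominationVec, if_pos h3, if_neg (Finset.disjoint_right.1 hdis h3)]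
    field_simp
    ring
  · simp only [dominationVec, if_neg h3, if_pos h4]
    field_simp
    ring
  · simp [dominationVec, h3, h4]

/-- The function supported on the vertices in batches before the `i`-th one and on `v`,
constant on the former, with total sum zero. -/
noncomputable def isolatedVec (i : Fin d) (v w : TV d m fun _ => k) : ℝ :=
  (Finset.univ.filter fun u : TV d m fun _ => k => batch u < i).card * (if w = v then 1 else 0) -
    (if batch w < i then 1 else 0)

/-- A common eigenvector of all the operators `dominationLaplacian j`, for each vertex. -/
noncomputable def thrEigenvec : TV d m (fun _ => k) → TV d m (fun _ => k) → ℝ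
  | Sum.inl ⟨i, a⟩ =>
    if a.val = 0 then
      if i.val = 0 then fun _ => 1 else isolatedVec i (Sum.inl ⟨i, a⟩)
    else Pi.single (Sum.inl ⟨i, a⟩) 1 - Pi.single (Sum.inl ⟨i, ⟨0, a.pos⟩⟩) 1
  | Sum.inr ⟨i, b⟩ =>
    if b.val = 0 then dominationVec i
    else Pi.single (Sum.inr ⟨i, b⟩) 1 - Pi.single (Sum.inr ⟨i, ⟨0, b.pos⟩⟩) 1

/-- The eigenvalue of `dominationLaplacian j` at `thrEigenvec v`. -/
noncomputable def dominationEigenvalue : TV d m (fun _ => k) → Fin d → ℝ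
  | Sum.inl ⟨i, a⟩, j => if a.val = 0 ∧ i.val = 0 then 0 else if i ≤ j then 1 else 0
  | Sum.inr ⟨i, b⟩, j =>
    if i < j then 1
    else if i = j then
      if b.val = 0 then ((before d m (fun _ => k) i).card : ℝ) / k + 1
      else (before d m (fun _ => k) i).card * (k + 1) / k
    else 0

lemma batch_inr (i : Fin d) (b : Fin k) :
    batch (Sum.inr ⟨i, b⟩ : TV d m fun _ => k) = i := rfl

lemma dominationLaplacian_thrEigenvec (hk : 1 ≤ k) (j : Fin d) (v w : TV d m fun _ => k) :
    dominationLaplacian j (thrEigenvec v) w = dominationEigenvalue v j * thrEigenvec v w := by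
  rcases v with ⟨i, a⟩ | ⟨i, b⟩
  · simp only [thrEigenvec, dominationEigenvalue]
    by_cases ha : a.val = 0
    · by_cases hi : i.val = 0
      · simp only [ha, hi, and_self, if_true, zero_mul]
        exact dominationLaplacian_eq_zero hk 1 (fun _ _ => rfl) (fun _ _ => rfl) w
      · simp only [ha, hi, if_true, if_false, and_false]
        split_ifs with hij
        · rw [one_mul]
          refine dominationLaplacian_eq_self ?_ ?_ ?_ w
          · rintro (⟨i', a'⟩ | ⟨i', b'⟩) h
            · exact absurd h inl_not_mem_domSet
            · rw [inr_mem_domSet] at h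
              subst h
              simp [isolatedVec, batch_inr, hij.not_gt]
          · intro u hu
            have h1 : u ≠ Sum.inl ⟨i, a⟩ := fun h => hu (h ▸ inl_mem_before.2 hij)
            have h2 : ¬ batch u < i := by
              rcases u with ⟨i', a'⟩ | ⟨i', b'⟩
              · rw [inl_mem_before, not_le] at hu
                exact (hij.trans hu.le).not_gt
              · rw [inr_mem_before, not_lt] at hu
                exact (hij.trans hu).not_gt
            simp [isolatedVec, h1, h2]
          · have h1 : (before d m (fun _ => k) j).filter (fun u => batch u < i) =
                Finset.univ.filter fun u => batch u < i := by
              ext u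
              simp only [mem_filter, mem_univ, true_and, and_iff_right_iff_imp]
              rcases u with ⟨i', a'⟩ | ⟨i', b'⟩
              · intro h
                exact inl_mem_before.2 (le_of_lt (lt_of_lt_of_le h hij))
              · intro h
                exact inr_mem_before.2 (lt_of_lt_of_le h hij)
            have h2 := (inl_mem_before (k := k) (a := a)).2 hij
            simp only [isolatedVec, Finset.sum_sub_distrib, ← Finset.mul_sum,
              Finset.sum_ite_eq', h2, if_true, Finset.sum_boole, h1]
            simp
        · rw [zero_mul]
          have hij' := not_le.1 hij
          refine dominationLaplacian_eq_zero hk (-1) ?_ ?_ w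
          · rintro (⟨i', a'⟩ | ⟨i', b'⟩) h
            · exact absurd h inl_not_mem_domSet
            · rw [inr_mem_domSet] at h
              subst h
              simp [isolatedVec, batch_inr, hij']
          · rintro u hu
            have h1 : u ≠ Sum.inl ⟨i, a⟩ := fun h => hij (inl_mem_before.1 (h ▸ hu))
            have h2 : batch u < i := by
              rcases u with ⟨i', a'⟩ | ⟨i', b'⟩
              · exact lt_of_le_of_lt (inl_mem_before.1 hu) hij'
              · exact lt_trans (inr_mem_before.1 hu) hij'
            simp [isolatedVec, h1, h2]
    · simp only [ha, if_false, false_and]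
      split_ifs with hij
      · rw [one_mul]
        refine dominationLaplacian_eq_self ?_ ?_ ?_ w
        · rintro (⟨i', a'⟩ | ⟨i', b'⟩) h
          · exact absurd h inl_not_mem_domSet
          · simp
        · intro u hu
          have h1 : ∀ a, u ≠ Sum.inl ⟨i, a⟩ := fun a h => hu (h ▸ inl_mem_before.2 hij)
          simp [h1]
        · simp [Finset.sum_sub_distrib, inl_mem_before, hij]
      · rw [zero_mul]
        refine dominationLaplacian_eq_zero hk 0 ?_ ?_ w
        · rintro (⟨i', a'⟩ | ⟨i', b'⟩) h
          · exact absurd h inl_not_mem_domSet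
          · simp
        · rintro u hu
          have h1 : ∀ a, u ≠ Sum.inl ⟨i, a⟩ := fun a h => hij (inl_mem_before.1 (h ▸ hu))
          simp [h1]
  · simp only [thrEigenvec, dominationEigenvalue]
    rcases lt_trichotomy i j with hij | rfl | hij
    · rw [if_pos hij, one_mul]
      have hS : ∀ u ∈ domSet d m (fun _ => k) j, u ∉ before d m (fun _ => k) i ∧
          u ∉ domSet d m (fun _ => k) i := by
        rintro (⟨i', a'⟩ | ⟨i', b'⟩) h
        · exact absurd h inl_not_mem_domSet
        · rw [inr_mem_domSet] at h
          subst h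
          rw [inr_mem_before, inr_mem_domSet]
          exact ⟨hij.not_gt, hij.ne'⟩
      have hB : before d m (fun _ => k) i ⊆ before d m (fun _ => k) j := by
        rintro (⟨i', a'⟩ | ⟨i', b'⟩) h
        · exact inl_mem_before.2 ((inl_mem_before.1 h).trans hij.le)
        · exact inr_mem_before.2 ((inr_mem_before.1 h).trans hij)
      have hSB : domSet d m (fun _ => k) i ⊆ before d m (fun _ => k) j := by
        rintro (⟨i', a'⟩ | ⟨i', b'⟩) h
        · exact absurd h inl_not_mem_domSet
        · rw [inr_mem_domSet] at h
          subst h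
          exact inr_mem_before.2 hij
      split_ifs with hb
      · refine dominationLaplacian_eq_self ?_ ?_ ?_ w
        · intro u hu
          simp [dominationVec, hS u hu]
        · intro u hu
          rw [dominationVec, if_neg fun h => hu (hSB h), if_neg fun h => hu (hB h)]
          simp
        · simp only [dominationVec, Finset.sum_sub_distrib, ← Finset.mul_sum, Finset.sum_boole,
            Finset.filter_mem_eq_inter, Finset.inter_eq_right.2 hB, Finset.inter_eq_right.2 hSB,
            card_domSet]
          ring
      · refine dominationLaplacian_eq_self ?_ ?_ ?_ w
        · intro u hu
          have h1 : ∀ b, u ≠ Sum.inr ⟨i, b⟩ := fun b h =>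
            (hS u hu).2 (h ▸ inr_mem_domSet.2 rfl)
          simp [h1]
        · intro u hu
          have h1 : ∀ b, u ≠ Sum.inr ⟨i, b⟩ := fun b h => hu (h ▸ inr_mem_before.2 hij)
          simp [h1]
        · simp [Finset.sum_sub_distrib, inr_mem_before, hij]
    · rw [if_neg (lt_irrefl _), if_pos rfl]
      split_ifs with hb
      · exact dominationLaplacian_dominationVec hk i w
      · refine dominationLaplacian_eq_of_supported ?_ ?_ w
        · intro u hu
          have h1 : ∀ b, u ≠ Sum.inr ⟨i, b⟩ := fun b h => hu (h ▸ inr_mem_domSet.2 rfl)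
          simp [h1]
        · simp [Finset.sum_sub_distrib, inr_mem_domSet]
    · rw [if_neg hij.not_gt, if_neg hij.ne', zero_mul]
      have hS : ∀ u ∈ domSet d m (fun _ => k) j, u ∈ before d m (fun _ => k) i := by
        rintro (⟨i', a'⟩ | ⟨i', b'⟩) h
        · exact absurd h inl_not_mem_domSet
        · rw [inr_mem_domSet] at h
          subst h
          exact inr_mem_before.2 hij
      have hB : ∀ u ∈ before d m (fun _ => k) j, u ∈ before d m (fun _ => k) i := by
        rintro (⟨i', a'⟩ | ⟨i', b'⟩) h
        · exact inl_mem_before.2 ((inl_mem_before.1 h).trans hij.le)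
        · exact inr_mem_before.2 ((inr_mem_before.1 h).trans hij)
      split_ifs with hb
      · have hc : ∀ u ∈ before d m (fun _ => k) i, dominationVec i u = - k := fun u hu => by
          simp [dominationVec, hu, Finset.disjoint_left.1 (disjoint_before_domSet i) hu]
        exact dominationLaplacian_eq_zero hk _ (fun u hu => hc u (hS u hu))
          (fun u hu => hc u (hB u hu)) w
      · have hc : ∀ u ∈ before d m (fun _ => k) i,
            (Pi.single (Sum.inr ⟨i, b⟩) 1 - Pi.single (Sum.inr ⟨i, ⟨0, b.pos⟩⟩) 1 :
              TV d m (fun _ => k) → ℝ) u = 0 := fun u hu => by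
          have h1 : ∀ b, u ≠ Sum.inr ⟨i, b⟩ := fun b h =>
            lt_irrefl i (inr_mem_before.1 (h ▸ hu))
          simp [h1]
        exact dominationLaplacian_eq_zero hk _ (fun u hu => hc u (hS u hu))
          (fun u hu => hc u (hB u hu)) w

lemma sum_dominationEigenvalue_inl (i : Fin d) (a : Fin (m i)) :
    ∑ j, dominationEigenvalue (Sum.inl ⟨i, a⟩ : TV d m fun _ => k) j =
      if a.val = 0 ∧ i.val = 0 then 0 else (d : ℝ) - i.val := by
  simp only [dominationEigenvalue]
  split_ifs with h
  · simp
  · rw [Finset.sum_boole, show Finset.univ.filter (fun j : Fin d => i ≤ j) = Finset.Ici i by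
      ext; simp, Fin.card_Ici, Nat.cast_sub i.isLt.le]

lemma sum_dominationEigenvalue_inr (hk : 1 ≤ k) (i : Fin d) (b : Fin k) :
    ∑ j, dominationEigenvalue (Sum.inr ⟨i, b⟩ : TV d m fun _ => k) j =
      if b.val = 0 then
        (1 / (k : ℝ)) * (∑ j ∈ Finset.univ.filter (fun j : Fin d => j ≤ i), (m j : ℝ)) + (d : ℝ)
      else ((k : ℝ) + 1) / (k : ℝ) *
          (∑ j ∈ Finset.univ.filter (fun j : Fin d => j ≤ i), (m j : ℝ)) +
        (k : ℝ) * i.val + (d : ℝ) - 1 := by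
  have hk0 : (k : ℝ) ≠ 0 := by positivity
  have key : ∀ x : ℝ, ∑ j, (if i < j then 1 else if i = j then x else 0) = (d : ℝ) - 1 - i + x := by
    intro x
    have h : ∀ j, (if i < j then 1 else if i = j then x else 0) =
        (if i < j then 1 else 0) + (if i = j then x else 0) := fun j => by
      rcases eq_or_ne i j with rfl | hij
      · simp
      · simp [hij]
    have hd := i.isLt
    rw [Finset.sum_congr rfl fun j _ => h j, Finset.sum_add_distrib, Finset.sum_boole,
      Finset.sum_ite_eq, if_pos (Finset.mem_univ i),
      show Finset.univ.filter (fun j : Fin d => i < j) = Finset.Ioi i by ext; simp, Fin.card_Ioi,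
      Nat.cast_sub (by omega), Nat.cast_sub (by omega), Nat.cast_one]
  simp only [dominationEigenvalue]
  rw [key, card_before]
  split_ifs <;> field_simp <;> ring

lemma eq_zero_of_forall_thrEigenvec (hd : 0 < d) (hm : 1 ≤ m ⟨0, hd⟩) (hk : 1 ≤ k)
    (f : TV d m (fun _ => k) → ℝ) (hf : ∀ v, ∑ w, f w * thrEigenvec v w = 0) : f = 0 := by
  set root : TV d m (fun _ => k) := Sum.inl ⟨⟨0, hd⟩, ⟨0, hm⟩⟩ with hroot
  have hinl : ∀ i (a : Fin (m i)), f (Sum.inl ⟨i, a⟩) = f (Sum.inl ⟨i, ⟨0, a.pos⟩⟩) := by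
    intro i a
    by_cases ha : a.val = 0
    · congr 3
      exact Fin.ext ha
    · have h := hf (Sum.inl ⟨i, a⟩)
      simp only [thrEigenvec, if_neg ha, Pi.sub_apply, mul_sub, Finset.sum_sub_distrib] at h
      simpa [Pi.single_apply, sub_eq_zero] using h
  have hinr : ∀ i (b : Fin k), f (Sum.inr ⟨i, b⟩) = f (Sum.inr ⟨i, ⟨0, b.pos⟩⟩) := by
    intro i b
    by_cases hb : b.val = 0
    · congr 3
      exact Fin.ext hb
    · have h := hf (Sum.inr ⟨i, b⟩)
      simp only [thrEigenvec, if_neg hb, Pi.sub_apply, mul_sub, Finset.sum_sub_distrib] at h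
      simpa [Pi.single_apply, sub_eq_zero] using h
  have hconst : ∀ n, ∀ v : TV d m (fun _ => k), (batch v).val = n → f v = f root := by
    intro n
    induction n using Nat.strong_induction_on with
    | _ n ih =>
    have h1 : ∀ i (a : Fin (m i)), i.val = n → f (Sum.inl ⟨i, a⟩) = f root := by
      intro i a hi
      rw [hinl]
      by_cases hi0 : i.val = 0
      · obtain rfl : i = ⟨0, hd⟩ := Fin.ext hi0
        rfl
      · have h := hf (Sum.inl ⟨i, ⟨0, a.pos⟩⟩)
        simp only [thrEigenvec, if_true, if_neg hi0, isolatedVec, mul_sub,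
          Finset.sum_sub_distrib, mul_ite, mul_one, mul_zero, Finset.sum_ite_eq',
          Finset.mem_univ] at h
        have hC : ∀ u ∈ Finset.univ.filter (fun u : TV d m fun _ => k => batch u < i),
            f u = f root := fun u hu => ih _ (hi ▸ (Finset.mem_filter.1 hu).2) u rfl
        rw [← Finset.sum_filter, Finset.sum_congr rfl hC, Finset.sum_const, nsmul_eq_mul, mul_comm, ← mul_sub] at h
        refine sub_eq_zero.1 ((mul_eq_zero.1 h).resolve_left ?_)
        rw [← ne_eq, Nat.cast_ne_zero, ← Nat.pos_iff_ne_zero, Finset.card_pos]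
        exact ⟨root, Finset.mem_filter.2 ⟨Finset.mem_univ _, Nat.pos_of_ne_zero hi0⟩⟩
    rintro (⟨i, a⟩ | ⟨i, b⟩) hi
    · exact h1 i a hi
    · have hk0 : (k : ℝ) ≠ 0 := by positivity
      replace hi : i.val = n := hi
      rw [hinr]
      have h := hf (Sum.inr ⟨i, ⟨0, b.pos⟩⟩)
      have hB : ∀ u ∈ before d m (fun _ => k) i, f u = f root := by
        rintro (⟨i', a'⟩ | ⟨i', b'⟩) hu
        · rcases (inl_mem_before.1 hu).lt_or_eq with h2 | rfl
          · exact ih _ (hi ▸ h2) _ rfl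
          · exact h1 _ _ hi
        · exact ih _ (hi ▸ inr_mem_before.1 hu) _ rfl
      have hS : ∀ u ∈ domSet d m (fun _ => k) i, f u = f (Sum.inr ⟨i, ⟨0, b.pos⟩⟩) := by
        rintro (⟨i', a'⟩ | ⟨i', b'⟩) hu
        · exact absurd hu inl_not_mem_domSet
        · rw [inr_mem_domSet] at hu
          subst hu
          exact hinr _ _
      simp only [thrEigenvec, if_true, dominationVec, mul_sub, Finset.sum_sub_distrib, mul_ite,
        mul_one, mul_zero, ← Finset.sum_filter, Finset.filter_univ_mem, ← Finset.sum_mul] at h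
      rw [Finset.sum_congr rfl hS, Finset.sum_congr rfl hB, Finset.sum_const, Finset.sum_const,
        card_domSet, nsmul_eq_mul, nsmul_eq_mul] at h
      have hn : ((before d m (fun _ => k) i).card : ℝ) ≠ 0 := by
        rw [Nat.cast_ne_zero, ← Nat.pos_iff_ne_zero, Finset.card_pos]
        exact ⟨root, inl_mem_before.2 (Nat.zero_le _)⟩
      refine sub_eq_zero.1 ((mul_eq_zero.1 (?_ : ((k : ℝ) * _) * _ = 0)).resolve_left
        (mul_ne_zero hk0 hn))
      linarith
  have h := hf root
  simp only [hroot, thrEigenvec, if_true, mul_one] at h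
  rw [Finset.sum_congr rfl (fun v _ => hconst _ v rfl), Finset.sum_const, nsmul_eq_mul] at h
  have h0 : f root = 0 := by
    refine (mul_eq_zero.1 h).resolve_left ?_
    rw [← ne_eq, Nat.cast_ne_zero, ← Nat.pos_iff_ne_zero, Finset.card_pos]
    exact ⟨root, Finset.mem_univ _⟩
  funext v
  rw [hconst _ v rfl, h0, Pi.zero_apply]

lemma lapMatrix_thrEdges_charpoly_roots (hd : 0 < d) (hm : 1 ≤ m ⟨0, hd⟩) (hk : 1 ≤ k) :
    (lapMatrix (thrEdges d m fun _ => k)).charpoly.roots =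
      Finset.univ.val.map fun v : TV d m (fun _ => k) => ∑ j, dominationEigenvalue v j := by
  refine Matrix.charpoly_roots_of_mul_eq_mul_diagonal _
    (Matrix.of fun w v => thrEigenvec v w) _ ?_ ?_
  · intro h
    obtain ⟨f, hf0, hf⟩ := Matrix.exists_vecMul_eq_zero_iff.2 h
    exact hf0 (eq_zero_of_forall_thrEigenvec hd hm hk f fun v => congrFun hf v)
  · ext w v
    rw [Matrix.mul_diagonal]
    refine (lapMatrix_thrEdges_mulVec hk (thrEigenvec v) w).trans ?_
    rw [Finset.sum_congr rfl fun j _ => dominationLaplacian_thrEigenvec hk j v w,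
      ← Finset.sum_mul, mul_comm]
    rfl

end Threshold

lemma Multiset.sum_fin_singleton_ite {α : Type*} {n : ℕ} (hn : 1 ≤ n) (x y : α) :
    ∑ a : Fin n, ({if a.val = 0 then x else y} : Multiset α) =
      {x} + Multiset.replicate (n - 1) y := by
  obtain ⟨n, rfl⟩ := Nat.exists_eq_add_of_le' hn
  simp [Fin.sum_univ_succ, Multiset.nsmul_singleton]

/-- The complete Laplacian spectrum of the `k`-threshold hypergraph
`0^{m₁} k 0^{m₂} k ⋯ 0^{m_d} k` (here `0`-indexed: `m i` for `i : Fin d`). -/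
theorem stmt_7 (d : ℕ) (hd : 0 < d) (m : Fin d → ℕ) (k : ℕ)
    (hm : 1 ≤ m ⟨0, hd⟩) (hk : 1 ≤ k) :
    (lapMatrix (thrEdges d m fun _ => k)).charpoly.roots =
      ((0 : ℝ) ::ₘ
        (Finset.univ.val.bind fun i : Fin d =>
          Multiset.replicate (if i.val = 0 then m i - 1 else m i) ((d : ℝ) - i.val)))
      + (Finset.univ.val.bind fun i : Fin d =>
          {(1 / (k : ℝ)) *
              (∑ j ∈ Finset.univ.filter (fun j : Fin d => j ≤ i), (m j : ℝ)) + (d : ℝ)})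
      + (Finset.univ.val.bind fun i : Fin d =>
          Multiset.replicate (k - 1)
            (((k : ℝ) + 1) / (k : ℝ) *
                (∑ j ∈ Finset.univ.filter (fun j : Fin d => j ≤ i), (m j : ℝ)) +
              (k : ℝ) * i.val + (d : ℝ) - 1)) := by
  rw [lapMatrix_thrEdges_charpoly_roots hd hm hk]
  have hval : ∀ g : TV d m (fun _ => k) → ℝ, Finset.univ.val.map g = ∑ v, {g v} := fun g => by
    rw [← Multiset.sum_map_singleton (Finset.univ.val.map g), Multiset.map_map]
    rfl
  have hbind : ∀ g : Fin d → Multiset ℝ, Finset.univ.val.bind g = ∑ i, g i := fun _ => rfl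
  rw [hval, Fintype.sum_sum_type, Fintype.sum_sigma, Fintype.sum_sigma]
  simp only [hbind, sum_dominationEigenvalue_inl, sum_dominationEigenvalue_inr hk,
    Multiset.sum_fin_singleton_ite hk, Finset.sum_add_distrib]
  rw [← Multiset.singleton_add, add_assoc _ (∑ i : Fin d, _) (∑ i : Fin d, _)]
  congr 1
  have h : ∀ i : Fin d,
      ∑ a : Fin (m i), ({if a.val = 0 ∧ i.val = 0 then 0 else (d : ℝ) - i.val} : Multiset ℝ) =
        (if i = ⟨0, hd⟩ then {0} else 0) +
          Multiset.replicate (if i.val = 0 then m i - 1 else m i) ((d : ℝ) - i.val) := by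
    intro i
    by_cases hi : i.val = 0
    · obtain rfl : i = ⟨0, hd⟩ := Fin.ext hi
      simp only [and_true, if_true]
      exact Multiset.sum_fin_singleton_ite hm _ _
    · have hi' : i ≠ ⟨0, hd⟩ := fun h => hi (congrArg Fin.val h)
      simp [hi, hi', Multiset.nsmul_singleton]
  rw [Finset.sum_congr rfl fun i _ => h i, Finset.sum_add_distrib]
  simp
end
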